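/- Let n ≥ 2, let M = (a, b; c, d) ∈ SAV(ℝ⊕ℝ^{n−1}), and let x ∈ H⁺. Then cx+d is invertible in Cl_n, M<x> = (ax+b)(cx+d)^{−1} is a paravector lying in H⁺, and its e_n-coordinate equals (M<x>)_n = x_n/‖cx+d‖². -/

import Mathlib

noncomputable section

open scoped symmDiff

/-- An explicit model of the real Clifford algebra `Cl_n` with generators `e 0, …, e (n-1)`
satisfying `eᵢ eⱼ + eⱼ eᵢ = -2 δᵢⱼ` (the Clifford algebra of the negative definite
quadratic form on `ℝⁿ`): elements are coordinate functions on the canonical basis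
`(e_A)_{A ⊆ {0,…,n-1}}`, where `e_A` is the (increasingly ordered) product of the `e i`, `i ∈ A`. -/
def Cl (n : ℕ) : Type := Finset (Fin n) → ℝ

namespace Cl

variable {n : ℕ}

instance : NormedAddCommGroup (Cl n) :=
  inferInstanceAs (NormedAddCommGroup (Finset (Fin n) → ℝ))

instance : NormedSpace ℝ (Cl n) :=
  inferInstanceAs (NormedSpace ℝ (Finset (Fin n) → ℝ))

/-- The coefficient of `a` at the basis element `e_A`. -/
def coeff (a : Cl n) (A : Finset (Fin n)) : ℝ := a A

/-- The sign occurring in the product `e_A * e_B = mulSign A B • e_{A ∆ B}`,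
coming from the relations `eᵢ eⱼ = -eⱼ eᵢ` (i ≠ j) and `eᵢ² = -1`. -/
def mulSign (A B : Finset (Fin n)) : ℝ :=
  (-1 : ℝ) ^ (((A ×ˢ B).filter fun p => p.2 < p.1).card + (A ∩ B).card)

/-- Clifford multiplication. -/
def mul (a b : Cl n) : Cl n := fun C =>
  ∑ A : Finset (Fin n), ∑ B : Finset (Fin n),
    if A ∆ B = C then mulSign A B * a A * b B else 0

/-- The unit `1` of the Clifford algebra. -/
def one : Cl n := Pi.single ∅ 1

/-- The embedding of the real scalars. -/
def scalar (r : ℝ) : Cl n := Pi.single ∅ r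

/-- The generators `e i` (in the paper: `e_1, …, e_n`). -/
def e (i : Fin n) : Cl n := Pi.single {i} 1

/-- Reversion: the anti-automorphism fixing all the `e i`. -/
def reverse (a : Cl n) : Cl n := fun A => (-1 : ℝ) ^ (A.card * (A.card - 1) / 2) * a A

/-- The main involution `′`: the automorphism with `(e i)′ = - e i`. -/
def involute (a : Cl n) : Cl n := fun A => (-1 : ℝ) ^ A.card * a A

/-- Clifford conjugation: the anti-automorphism with `conj (e i) = - e i`
(the composite of reversion and the main involution). -/
def conj (a : Cl n) : Cl n := fun A => (-1 : ℝ) ^ (A.card * (A.card + 1) / 2) * a A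

/-- The norm on `Cl n`: the square root of the sum of the squares of the
coordinates in the standard basis. -/
def norm (a : Cl n) : ℝ := Real.sqrt (∑ A : Finset (Fin n), a A ^ 2)

/-- Invertibility in the Clifford algebra. -/
def IsInvertible (a : Cl n) : Prop := ∃ b, mul a b = one ∧ mul b a = one

/-- The inverse of an invertible Clifford number (junk value `0` otherwise). -/
def inv (a : Cl n) : Cl n :=
  letI := Classical.propDecidable (IsInvertible a)
  if h : IsInvertible a then h.choose else 0

/-- The paravector `x₀ + x₁ e₁ + ⋯ + xₙ eₙ` attached to `x ∈ ℝ^{n+1}`. -/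
def para (x : Fin (n + 1) → ℝ) : Cl n :=
  scalar (x 0) + ∑ i : Fin n, x i.succ • e i

/-- Being a paravector. -/
def IsParavector (a : Cl n) : Prop := ∃ x : Fin (n + 1) → ℝ, a = para x

/-- The coordinates in `ℝ^{n+1}` of (the paravector part of) a Clifford number. -/
def paraCoord (a : Cl n) : Fin (n + 1) → ℝ :=
  Fin.cases (coeff a ∅) (fun i => coeff a {i})

/-- Being a (possibly empty) product of nonzero paravectors. -/
def IsProdOfParavectors (a : Cl n) : Prop :=
  ∃ l : List (Fin (n + 1) → ℝ), (∀ x ∈ l, x ≠ 0) ∧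
    a = l.foldr (fun x b => mul (para x) b) one

/-- The special Ahlfors–Vahlen group `SAV(ℝ ⊕ ℝⁿ)`: 2×2 matrices `(a b; c d)` with entries
in `Cl n` such that each entry is `0` or a product of nonzero paravectors,
`a ⬝ reverse d - b ⬝ reverse c = 1`, and `a c⁻¹, c⁻¹ d` are paravectors if `c ≠ 0`
resp. `b d⁻¹` is a paravector if `c = 0`. -/
structure SAV (n : ℕ) where
  a : Cl n
  b : Cl n
  c : Cl n
  d : Cl n
  prod_a : a = 0 ∨ IsProdOfParavectors a
  prod_b : b = 0 ∨ IsProdOfParavectors b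
  prod_c : c = 0 ∨ IsProdOfParavectors c
  prod_d : d = 0 ∨ IsProdOfParavectors d
  det : mul a (reverse d) - mul b (reverse c) = one
  cond_c : c ≠ 0 → IsParavector (mul a (inv c)) ∧ IsParavector (mul (inv c) d)
  cond_c0 : c = 0 → IsParavector (mul b (inv d))

/-- The Clifford number `c x + d` attached to a matrix `M` and `x ∈ ℝ^{n+1}`. -/
def cxd (M : SAV n) (x : Fin (n + 1) → ℝ) : Cl n := mul M.c (para x) + M.d

/-- The numerator `a x + b`. -/
def axb (M : SAV n) (x : Fin (n + 1) → ℝ) : Cl n := mul M.a (para x) + M.b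

/-- The Möbius transformation `M<x> = (ax+b)(cx+d)⁻¹` as a Clifford number. -/
def moebiusCl (M : SAV n) (x : Fin (n + 1) → ℝ) : Cl n := mul (axb M x) (inv (cxd M x))

/-- The Möbius transformation `M<x>` as a point of `ℝ^{n+1}`. -/
def moebius (M : SAV n) (x : Fin (n + 1) → ℝ) : Fin (n + 1) → ℝ :=
  paraCoord (moebiusCl M x)

/-- `a` lies in the subalgebra `Cl_{n-1}` generated by the `e j` with `j ≠ i`. -/
def memSub (a : Cl n) (i : Fin n) : Prop := ∀ A : Finset (Fin n), i ∈ A → coeff a A = 0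

/-- The subgroup `SAV(ℝ ⊕ ℝ^{m})` of `SAV(ℝ ⊕ ℝ^{m+1})` of matrices whose entries lie
in the subalgebra `Cl_m ⊆ Cl_{m+1}`. -/
structure SAVsub (m : ℕ) extends SAV (m + 1) where
  sub_a : memSub a (Fin.last m)
  sub_b : memSub b (Fin.last m)
  sub_c : memSub c (Fin.last m)
  sub_d : memSub d (Fin.last m)

/-- The `P`-part of `a ∈ Cl_{m+1} = Cl_m ⊕ Cl_m e_{top}`: `a = P a + (Q a) e_top`. -/
def Ppart {m : ℕ} (a : Cl (m + 1)) : Cl (m + 1) := fun A =>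
  if Fin.last m ∈ A then 0 else a A

/-- The `Q`-part of `a ∈ Cl_{m+1} = Cl_m ⊕ Cl_m e_{top}`: `a = P a + (Q a) e_top`. -/
def Qpart {m : ℕ} (a : Cl (m + 1)) : Cl (m + 1) := fun A =>
  if Fin.last m ∈ A then 0 else a (insert (Fin.last m) A)

/-- Partial derivative `∂f/∂xᵢ`. -/
def pderiv {E : Type*} [NormedAddCommGroup E] [NormedSpace ℝ E] {m : ℕ}
    (i : Fin m) (f : (Fin m → ℝ) → E) (x : Fin m → ℝ) : E :=
  fderiv ℝ f x (Pi.single i 1)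

/-- The Euclidean Laplacian `Δ = Σᵢ ∂²/∂xᵢ²` (acting componentwise). -/
def lap {E : Type*} [NormedAddCommGroup E] [NormedSpace ℝ E] {m : ℕ}
    (f : (Fin m → ℝ) → E) : (Fin m → ℝ) → E :=
  fun x => ∑ i : Fin m, pderiv i (pderiv i f) x

/-- The Euclidean Dirac operator `D f = ∂f/∂x₀ + Σᵢ eᵢ ∂f/∂xᵢ`. -/
def dirac (f : (Fin (n + 1) → ℝ) → Cl n) : (Fin (n + 1) → ℝ) → Cl n :=
  fun x => pderiv 0 f x + ∑ i : Fin n, mul (e i) (pderiv i.succ f x)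

/-- Upper half-space `H⁺ = {x ∈ ℝ^{n+1} : xₙ > 0}`. -/
def upperHalf (n : ℕ) : Set (Fin (n + 1) → ℝ) := {x | 0 < x (Fin.last n)}

/-- The Euclidean norm on `ℝ^m`. -/
def enorm {m : ℕ} (x : Fin m → ℝ) : ℝ := Real.sqrt (∑ i, x i ^ 2)

end Cl

namespace Cl

variable {n : ℕ}

/-! ### The sign of a product of basis elements -/

theorem ext_apply {a b : Cl n} (h : ∀ A : Finset (Fin n), a A = b A) : a = b := funext h

theorem add_apply (a b : Cl n) (A : Finset (Fin n)) : (a + b) A = a A + b A := rfl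

theorem smul_apply (r : ℝ) (a : Cl n) (A : Finset (Fin n)) : (r • a) A = r * a A := rfl

theorem zero_apply (A : Finset (Fin n)) : (0 : Cl n) A = 0 := rfl

theorem mulSign_eq_prod (A B : Finset (Fin n)) :
    mulSign A B = ∏ a ∈ A, ∏ b ∈ B, if b ≤ a then (-1 : ℝ) else 1 := by
  rw [← Finset.prod_product' (f := fun a b => if b ≤ a then (-1 : ℝ) else 1),
    Finset.prod_ite, Finset.prod_const, Finset.prod_const_one, mul_one, mulSign]
  congr 1
  have hdiag : (A ∩ B).card = ((A ×ˢ B).filter fun p => p.2 = p.1).card := by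
    refine Finset.card_bij (fun a _ => (a, a)) ?_ ?_ ?_
    · simp
    · simp
    · rintro ⟨a, b⟩ h
      simp only [Finset.mem_filter, Finset.mem_product] at h
      obtain ⟨⟨ha, hb⟩, rfl⟩ := h
      exact ⟨b, by simp [ha, hb], rfl⟩
  rw [hdiag, ← Finset.card_union_of_disjoint, ← Finset.filter_or]
  · simp only [le_iff_lt_or_eq]
  · rw [Finset.disjoint_filter]
    intro p _ h h'
    exact h.ne h'

theorem prod_symmDiff {ι : Type*} [DecidableEq ι] (A B : Finset ι) (f : ι → ℝ)
    (hf : ∀ i, f i * f i = 1) :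
    ∏ i ∈ A ∆ B, f i = (∏ i ∈ A, f i) * ∏ i ∈ B, f i := by
  have hA := Finset.prod_inter_mul_prod_sdiff A B f
  have hB := Finset.prod_inter_mul_prod_sdiff B A f
  have hI : (∏ i ∈ A ∩ B, f i) * ∏ i ∈ A ∩ B, f i = 1 := by
    rw [← Finset.prod_mul_distrib]
    exact Finset.prod_eq_one fun i _ => hf i
  have hd : A ∆ B = (A \ B) ∪ (B \ A) := rfl
  rw [hd, Finset.prod_union disjoint_sdiff_sdiff, ← hA, ← hB, Finset.inter_comm B A]
  linear_combination (-(∏ i ∈ A \ B, f i) * ∏ i ∈ B \ A, f i) * hI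

theorem mulSign_mul_self (A B : Finset (Fin n)) : mulSign A B * mulSign A B = 1 := by
  rw [mulSign, ← mul_pow]
  norm_num

theorem mulSign_symmDiff_left (A B C : Finset (Fin n)) :
    mulSign (A ∆ B) C = mulSign A C * mulSign B C := by
  simp only [mulSign_eq_prod]
  refine prod_symmDiff _ _ _ fun i => ?_
  rw [← Finset.prod_mul_distrib]
  exact Finset.prod_eq_one fun j _ => by split_ifs <;> norm_num

theorem mulSign_symmDiff_right (A B C : Finset (Fin n)) :
    mulSign A (B ∆ C) = mulSign A B * mulSign A C := by
  simp only [mulSign_eq_prod]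
  rw [← Finset.prod_mul_distrib]
  refine Finset.prod_congr rfl fun a _ => prod_symmDiff _ _ _ fun i => ?_
  split_ifs <;> norm_num

theorem mulSign_empty_left (A : Finset (Fin n)) : mulSign ∅ A = 1 := by
  simp [mulSign_eq_prod]

theorem mulSign_empty_right (A : Finset (Fin n)) : mulSign A ∅ = 1 := by
  simp [mulSign_eq_prod]

/-- The sign of conjugation on `e_A` is the sign of `e_A * e_A`. -/
theorem mulSign_self (A : Finset (Fin n)) :
    mulSign A A = (-1 : ℝ) ^ (A.card * (A.card + 1) / 2) := by
  induction A using Finset.induction_on_max with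
  | empty => simp [mulSign]
  | insert a s hs ih =>
    have ha : a ∉ s := fun h => lt_irrefl _ (hs a h)
    have h1 : (∏ x ∈ s, if a ≤ x then (-1 : ℝ) else 1) = 1 :=
      Finset.prod_eq_one fun x hx => if_neg (hs x hx).not_ge
    have h2 : (∏ x ∈ s, if x ≤ a then (-1 : ℝ) else 1) = (-1) ^ s.card :=
      Finset.prod_eq_pow_card fun x hx => if_pos (hs x hx).le
    have h3 : (s.card + 1) * (s.card + 1 + 1) / 2 = s.card * (s.card + 1) / 2 + (s.card + 1) := by
      rw [show (s.card + 1) * (s.card + 1 + 1) = s.card * (s.card + 1) + (s.card + 1) * 2 by ring,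
        Nat.add_mul_div_right _ _ two_pos]
    rw [mulSign_eq_prod] at ih
    rw [mulSign_eq_prod, Finset.prod_insert ha, Finset.prod_insert ha, h2]
    simp only [Finset.prod_insert ha]
    rw [Finset.prod_mul_distrib, h1, ih, Finset.card_insert_of_notMem ha, h3, pow_add, pow_succ]
    simp only [le_refl, if_true]
    ring

/-! ### The ring structure -/

theorem mul_apply (a b : Cl n) (C : Finset (Fin n)) :
    mul a b C = ∑ A : Finset (Fin n), mulSign A (A ∆ C) * a A * b (A ∆ C) := by
  unfold mul
  refine Finset.sum_congr rfl fun A _ => ?_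
  rw [Finset.sum_eq_single (A ∆ C)]
  · rw [if_pos (symmDiff_symmDiff_cancel_left A C)]
  · intro B _ hB
    refine if_neg fun h => hB ?_
    rw [← h, symmDiff_symmDiff_cancel_left]
  · simp

theorem sum_symmDiff_left (A : Finset (Fin n)) (f : Finset (Fin n) → ℝ) :
    ∑ B, f (A ∆ B) = ∑ B, f B :=
  Equiv.sum_comp (Function.Involutive.toPerm (fun B => A ∆ B)
    (symmDiff_symmDiff_cancel_left A)) f

theorem mul_assoc' (a b c : Cl n) : mul (mul a b) c = mul a (mul b c) := by
  refine ext_apply fun D => ?_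
  simp only [mul_apply, Finset.mul_sum, Finset.sum_mul]
  rw [Finset.sum_comm]
  refine Finset.sum_congr rfl fun A _ => ?_
  refine (sum_symmDiff_left A _).symm.trans ?_
  refine Finset.sum_congr rfl fun B _ => ?_
  have h1 : (A ∆ B) ∆ D = B ∆ (A ∆ D) := by
    rw [symmDiff_comm A B, symmDiff_assoc]
  rw [h1, symmDiff_symmDiff_cancel_left]
  simp only [mulSign_symmDiff_left, mulSign_symmDiff_right]
  linear_combination (mulSign A A * mulSign A D * mulSign B B * mulSign B A * mulSign B D *
    a A * b B * c (B ∆ (A ∆ D))) * mulSign_mul_self A B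

theorem one_apply (A : Finset (Fin n)) : (one : Cl n) A = if A = ∅ then 1 else 0 := by
  simp [one, Pi.single_apply]

theorem one_mul' (a : Cl n) : mul one a = a := by
  refine ext_apply fun C => ?_
  rw [mul_apply, Finset.sum_eq_single ∅]
  · have h : (∅ : Finset (Fin n)) ∆ C = C := bot_symmDiff C
    rw [h, one_apply, mulSign_empty_left]
    simp
  · intro A _ hA
    simp [one_apply, hA]
  · simp

theorem mul_one' (a : Cl n) : mul a one = a := by
  refine ext_apply fun C => ?_
  rw [mul_apply, Finset.sum_eq_single C]
  · have h : C ∆ C = ∅ := symmDiff_self C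
    rw [h, one_apply, mulSign_empty_right]
    simp
  · intro A _ hA
    have h : A ∆ C ≠ ∅ := fun h => hA (symmDiff_eq_bot.mp h)
    simp [one_apply, h]
  · simp

theorem mul_add' (a b c : Cl n) : mul a (b + c) = mul a b + mul a c := by
  refine ext_apply fun C => ?_
  simp only [mul_apply, add_apply, mul_add, Finset.sum_add_distrib]

theorem add_mul' (a b c : Cl n) : mul (a + b) c = mul a c + mul b c := by
  refine ext_apply fun C => ?_
  simp only [mul_apply, add_apply, mul_add, add_mul, Finset.sum_add_distrib]

theorem smul_mul' (r : ℝ) (a b : Cl n) : mul (r • a) b = r • mul a b := by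
  refine ext_apply fun C => ?_
  simp only [mul_apply, smul_apply, Finset.mul_sum]
  exact Finset.sum_congr rfl fun A _ => by ring

theorem mul_smul' (r : ℝ) (a b : Cl n) : mul a (r • b) = r • mul a b := by
  refine ext_apply fun C => ?_
  simp only [mul_apply, smul_apply, Finset.mul_sum]
  exact Finset.sum_congr rfl fun A _ => by ring

instance : Ring (Cl n) :=
  { (inferInstance : AddCommGroup (Cl n)) with
    mul := mul
    one := one
    mul_assoc := mul_assoc'
    one_mul := one_mul'
    mul_one := mul_one'
    left_distrib := mul_add'
    right_distrib := add_mul'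
    zero_mul := fun a => show mul 0 a = 0 by simpa using smul_mul' 0 0 a
    mul_zero := fun a => show mul a 0 = 0 by simpa using mul_smul' 0 a 0 }

instance : Algebra ℝ (Cl n) := Algebra.ofModule smul_mul' fun r a b => mul_smul' r a b

theorem mul_eq (a b : Cl n) : mul a b = a * b := rfl

theorem one_eq : (one : Cl n) = 1 := rfl

/-! ### The involutions -/

theorem conj_apply (a : Cl n) (A : Finset (Fin n)) : conj a A = mulSign A A * a A := by
  rw [mulSign_self]
  rfl

theorem involute_sign_symmDiff (A B : Finset (Fin n)) :
    (-1 : ℝ) ^ (A ∆ B).card = (-1) ^ A.card * (-1) ^ B.card := by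
  simpa using prod_symmDiff A B (fun _ => (-1 : ℝ)) (by norm_num)

theorem involute_mul (a b : Cl n) : involute (a * b) = involute a * involute b := by
  refine ext_apply fun C => ?_
  simp only [← mul_eq]
  rw [mul_apply]
  unfold involute
  rw [mul_apply, Finset.mul_sum]
  refine Finset.sum_congr rfl fun A _ => ?_
  rw [involute_sign_symmDiff]
  have h : (-1 : ℝ) ^ A.card * (-1) ^ A.card = 1 := by rw [← mul_pow]; norm_num
  linear_combination (-(-1 : ℝ) ^ C.card * mulSign A (A ∆ C) * a A * b (A ∆ C)) * h

theorem conj_mul (a b : Cl n) : conj (a * b) = conj b * conj a := by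
  refine ext_apply fun C => ?_
  simp only [← mul_eq]
  rw [conj_apply, mul_apply, mul_apply, ← sum_symmDiff_left C, Finset.mul_sum]
  refine Finset.sum_congr rfl fun A _ => ?_
  have h : (C ∆ A) ∆ C = A := by rw [symmDiff_comm C A, symmDiff_symmDiff_cancel_right]
  rw [h, symmDiff_comm C A, conj_apply, conj_apply]
  simp only [mulSign_symmDiff_left, mulSign_symmDiff_right]
  linear_combination (-mulSign C C * mulSign A A * mulSign C A * a (A ∆ C) * b A) *
    (mulSign A C ^ 2 * mulSign_mul_self A A + mulSign_mul_self A C)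

theorem conj_conj (a : Cl n) : conj (conj a) = a := by
  refine ext_apply fun A => ?_
  rw [conj_apply, conj_apply, ← mul_assoc, mulSign_mul_self, one_mul]

theorem involute_smul (r : ℝ) (a : Cl n) : involute (r • a) = r • involute a := by
  refine ext_apply fun A => ?_
  simp only [involute, smul_apply]
  ring

theorem involute_one : involute (1 : Cl n) = 1 := by
  refine ext_apply fun A => ?_
  rw [← one_eq]
  by_cases h : A = ∅ <;> simp [involute, one_apply, h]

theorem reverse_eq (a : Cl n) : reverse a = involute (conj a) := by
  refine ext_apply fun A => ?_
  simp only [reverse, involute, conj]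
  rw [← mul_assoc, ← pow_add]
  congr 1
  generalize A.card = k
  have h : k * (k + 1) / 2 = k * (k - 1) / 2 + k := by
    rw [← Nat.add_mul_div_right _ _ two_pos]
    cases k with
    | zero => rfl
    | succ k => rw [Nat.add_sub_cancel]; congr 1; ring
  rw [h, show k + (k * (k - 1) / 2 + k) = k * (k - 1) / 2 + 2 * k by ring, pow_add, pow_mul]
  norm_num

theorem reverse_mul (a b : Cl n) : reverse (a * b) = reverse b * reverse a := by
  simp only [reverse_eq, conj_mul, involute_mul]

/-! ### Grades and paravectors -/

/-- Vanishing of all coordinates of grade larger than `k`. -/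
def GradeLE (k : ℕ) (a : Cl n) : Prop := ∀ A : Finset (Fin n), k < A.card → a A = 0

theorem GradeLE.mul {k l : ℕ} {a b : Cl n} (ha : GradeLE k a) (hb : GradeLE l b) :
    GradeLE (k + l) (a * b) := by
  intro C hC
  rw [← mul_eq, mul_apply]
  refine Finset.sum_eq_zero fun A _ => ?_
  by_cases h : k < A.card
  · rw [ha A h]
    ring
  · have hcard : C.card ≤ A.card + (A ∆ C).card := by
      calc C.card = (A ∆ (A ∆ C)).card := by rw [symmDiff_symmDiff_cancel_left]
        _ ≤ (A ∪ A ∆ C).card := Finset.card_le_card symmDiff_le_sup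
        _ ≤ _ := Finset.card_union_le _ _
    rw [hb (A ∆ C) (by omega)]
    ring

theorem GradeLE.conj {k : ℕ} {a : Cl n} (ha : GradeLE k a) : GradeLE k (conj a) := by
  intro A hA
  rw [conj_apply, ha A hA, mul_zero]

theorem para_apply (x : Fin (n + 1) → ℝ) (A : Finset (Fin n)) :
    para x A = (if A = ∅ then x 0 else 0) + ∑ i, if A = {i} then x i.succ else 0 := by
  have h1 : scalar (x 0) A = if A = ∅ then x 0 else 0 := by simp [scalar, Pi.single_apply]
  have h2 : (∑ i : Fin n, x i.succ • e i) A = ∑ i : Fin n, (x i.succ • e i) A :=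
    Finset.sum_apply (M := fun _ : Finset (Fin n) => ℝ) A _ _
  rw [para, add_apply, h1, h2]
  congr 1
  refine Finset.sum_congr rfl fun i _ => ?_
  rw [smul_apply]
  simp [e, Pi.single_apply]

theorem para_apply_empty (x : Fin (n + 1) → ℝ) : para x ∅ = x 0 := by
  simp [para_apply, (Finset.singleton_ne_empty _).symm]

theorem para_apply_singleton (x : Fin (n + 1) → ℝ) (j : Fin n) : para x {j} = x j.succ := by
  simp [para_apply]

theorem gradeLE_para (x : Fin (n + 1) → ℝ) : GradeLE 1 (para x) := by
  intro A hA
  have h0 : A ≠ ∅ := by rintro rfl; simp at hA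
  have h1 : ∀ i, A ≠ {i} := by rintro i rfl; simp at hA
  simp [para_apply, h0, h1]

theorem isParavector_iff {a : Cl n} : IsParavector a ↔ GradeLE 1 a := by
  refine ⟨?_, fun h => ⟨paraCoord a, ?_⟩⟩
  · rintro ⟨x, rfl⟩
    exact gradeLE_para x
  · refine ext_apply fun A => ?_
    rcases lt_or_ge 1 A.card with hA | hA
    · rw [h A hA, gradeLE_para _ A hA]
    · rcases Nat.le_one_iff_eq_zero_or_eq_one.mp hA with hA | hA
      · rw [Finset.card_eq_zero.mp hA, para_apply_empty]
        rfl
      · obtain ⟨i, rfl⟩ := Finset.card_eq_one.mp hA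
        rw [para_apply_singleton]
        rfl

theorem IsParavector.add {a b : Cl n} (ha : IsParavector a) (hb : IsParavector b) :
    IsParavector (a + b) := by
  rw [isParavector_iff] at *
  intro A hA
  rw [add_apply, ha A hA, hb A hA, add_zero]

theorem IsParavector.smul {a : Cl n} (r : ℝ) (ha : IsParavector a) : IsParavector (r • a) := by
  rw [isParavector_iff] at *
  intro A hA
  rw [smul_apply, ha A hA, mul_zero]

theorem IsParavector.conj {a : Cl n} (ha : IsParavector a) : IsParavector (conj a) := by
  rw [isParavector_iff] at *
  exact ha.conj

theorem IsParavector.reverse_eq {a : Cl n} (ha : IsParavector a) : reverse a = a := by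
  rw [isParavector_iff] at ha
  refine ext_apply fun A => ?_
  unfold reverse
  rcases lt_or_ge 1 A.card with hA | hA
  · rw [ha A hA, mul_zero]
  · interval_cases A.card <;> norm_num

theorem IsParavector.involute_eq {a : Cl n} (ha : IsParavector a) : involute a = Cl.conj a := by
  rw [isParavector_iff] at ha
  refine ext_apply fun A => ?_
  unfold involute Cl.conj
  rcases lt_or_ge 1 A.card with hA | hA
  · rw [ha A hA, mul_zero, mul_zero]
  · interval_cases A.card <;> norm_num

theorem IsParavector.sandwich {w z : Cl n} (hw : IsParavector w) (hz : IsParavector z) :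
    IsParavector (w * z * w) := by
  have hrev : reverse (w * z * w) = w * z * w := by
    rw [reverse_mul, reverse_mul, hw.reverse_eq, hz.reverse_eq, mul_assoc]
  rw [isParavector_iff] at *
  intro A hA
  rcases lt_or_ge 3 A.card with h | h
  · exact ((hw.mul hz).mul hw) A h
  · have h1 : (-1 : ℝ) ^ (A.card * (A.card - 1) / 2) * (w * z * w) A = (w * z * w) A :=
      congrFun hrev A
    have h2 : A.card = 2 ∨ A.card = 3 := by omega
    rcases h2 with h2 | h2 <;> rw [h2] at h1 <;> norm_num at h1 <;> linarith

/-! ### Products of paravectors -/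

theorem norm_sq (a : Cl n) : norm a ^ 2 = ∑ A : Finset (Fin n), a A ^ 2 :=
  Real.sq_sqrt (Finset.sum_nonneg fun _ _ => sq_nonneg _)

theorem norm_sq_pos {a : Cl n} (ha : a ≠ 0) : 0 < norm a ^ 2 := by
  rw [norm_sq]
  obtain ⟨A, hA⟩ : ∃ A : Finset (Fin n), a A ≠ 0 := by
    by_contra! h
    exact ha (ext_apply h)
  exact Finset.sum_pos' (fun _ _ => sq_nonneg _) ⟨A, Finset.mem_univ _, by positivity⟩

theorem norm_conj (a : Cl n) : norm (conj a) ^ 2 = norm a ^ 2 := by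
  rw [norm_sq, norm_sq]
  refine Finset.sum_congr rfl fun A _ => ?_
  rw [conj_apply]
  linear_combination a A ^ 2 * mulSign_mul_self A A

theorem mul_conj_apply_empty (a : Cl n) : (a * conj a) ∅ = norm a ^ 2 := by
  rw [← mul_eq, mul_apply, norm_sq]
  refine Finset.sum_congr rfl fun A _ => ?_
  have h : A ∆ ∅ = A := symmDiff_bot A
  rw [h, conj_apply]
  linear_combination a A ^ 2 * mulSign_mul_self A A

theorem IsParavector.mul_conj {z : Cl n} (hz : IsParavector z) :
    z * Cl.conj z = norm z ^ 2 • (1 : Cl n) := by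
  have hself : Cl.conj (z * Cl.conj z) = z * Cl.conj z := by rw [conj_mul, conj_conj]
  rw [isParavector_iff] at hz
  refine ext_apply fun A => ?_
  rw [smul_apply, ← one_eq, one_apply]
  split_ifs with hA
  · rw [hA, mul_conj_apply_empty, mul_one]
  · rw [mul_zero]
    rcases lt_or_ge 2 A.card with h | h
    · exact (hz.mul hz.conj) A h
    · have h1 : (-1 : ℝ) ^ (A.card * (A.card + 1) / 2) * (z * Cl.conj z) A = (z * Cl.conj z) A :=
        congrFun hself A
      have h0 : A.card ≠ 0 := fun h => hA (Finset.card_eq_zero.mp h)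
      have h2 : A.card = 1 ∨ A.card = 2 := by omega
      rcases h2 with h2 | h2 <;> rw [h2] at h1 <;> norm_num at h1 <;> linarith

/-- Elements `g` with `g * conj g = conj g * g = ‖g‖² ≠ 0` for which `z ↦ g' * z * conj g`
preserves the paravectors; this covers all products of nonzero paravectors. -/
structure IsVersor (g : Cl n) : Prop where
  ne_zero : g ≠ 0
  mul_conj : g * conj g = norm g ^ 2 • (1 : Cl n)
  conj_mul : conj g * g = norm g ^ 2 • (1 : Cl n)
  sandwich : ∀ z, IsParavector z → IsParavector (involute g * z * conj g)

theorem IsParavector.isVersor {z : Cl n} (hz : IsParavector z) (h0 : z ≠ 0) : IsVersor z where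
  ne_zero := h0
  mul_conj := hz.mul_conj
  conj_mul := by simpa only [conj_conj, norm_conj] using hz.conj.mul_conj
  sandwich := fun w hw => by
    rw [hz.involute_eq]
    exact hz.conj.sandwich hw

theorem one_ne_zero' : (1 : Cl n) ≠ 0 := fun h => by
  have := congrFun h ∅
  rw [← one_eq, one_apply] at this
  simp [zero_apply] at this

theorem IsVersor.norm_mul {g h : Cl n} (hg : IsVersor g) (hh : IsVersor h) :
    norm (g * h) ^ 2 = norm g ^ 2 * norm h ^ 2 := by
  rw [← mul_conj_apply_empty, Cl.conj_mul, mul_assoc, ← mul_assoc h, hh.mul_conj, smul_mul_assoc,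
    one_mul, mul_smul_comm, hg.mul_conj, smul_apply, smul_apply, ← one_eq, one_apply]
  simp [mul_comm]

theorem IsVersor.mul {g h : Cl n} (hg : IsVersor g) (hh : IsVersor h) : IsVersor (g * h) where
  ne_zero := fun h0 => by
    have h1 := hg.norm_mul hh
    have h2 := mul_pos (norm_sq_pos hg.ne_zero) (norm_sq_pos hh.ne_zero)
    rw [← h1, h0, norm_sq] at h2
    simp [zero_apply] at h2
  mul_conj := by
    rw [hg.norm_mul hh, Cl.conj_mul, mul_assoc, ← mul_assoc h, hh.mul_conj, smul_mul_assoc,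
      one_mul, mul_smul_comm, hg.mul_conj, smul_smul, mul_comm]
  conj_mul := by
    rw [hg.norm_mul hh, Cl.conj_mul, mul_assoc, ← mul_assoc _ g, hg.conj_mul, smul_mul_assoc,
      one_mul, mul_smul_comm, hh.conj_mul, smul_smul]
  sandwich := fun z hz => by
    have h1 := hg.sandwich _ (hh.sandwich z hz)
    rw [involute_mul, Cl.conj_mul]
    simpa only [mul_assoc] using h1

theorem isVersor_one : IsVersor (1 : Cl n) :=
  IsParavector.isVersor (isParavector_iff.mpr fun A hA => by
    have h0 : A ≠ ∅ := by rintro rfl; simp at hA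
    rw [← one_eq, one_apply, if_neg h0]) one_ne_zero'

theorem para_ne_zero {x : Fin (n + 1) → ℝ} (hx : x ≠ 0) : para x ≠ 0 := by
  refine fun h => hx (funext fun i => ?_)
  refine Fin.cases ?_ (fun j => ?_) i
  · rw [← para_apply_empty x, h]; rfl
  · rw [← para_apply_singleton x, h]; rfl

theorem IsProdOfParavectors.isVersor {g : Cl n} (hg : IsProdOfParavectors g) : IsVersor g := by
  obtain ⟨l, hl, rfl⟩ := hg
  induction l with
  | nil => exact isVersor_one
  | cons x l ih =>
    simp only [List.mem_cons, forall_eq_or_imp] at hl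
    exact (IsParavector.isVersor ⟨x, rfl⟩ (para_ne_zero hl.1)).mul (ih hl.2)

theorem IsVersor.isInvertible {g : Cl n} (hg : IsVersor g) : IsInvertible g := by
  have h0 := (norm_sq_pos hg.ne_zero).ne'
  refine ⟨(norm g ^ 2)⁻¹ • conj g, ?_, ?_⟩
  · rw [mul_eq, mul_smul_comm, hg.mul_conj, inv_smul_smul₀ h0, one_eq]
  · rw [mul_eq, smul_mul_assoc, hg.conj_mul, inv_smul_smul₀ h0, one_eq]

theorem IsVersor.inv_eq {g : Cl n} (hg : IsVersor g) : inv g = (norm g ^ 2)⁻¹ • conj g := by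
  have h0 := (norm_sq_pos hg.ne_zero).ne'
  have h1 : inv g * g = 1 := by
    unfold inv
    rw [dif_pos hg.isInvertible]
    exact hg.isInvertible.choose_spec.2
  calc inv g = (norm g ^ 2)⁻¹ • (inv g * (g * conj g)) := by
        rw [hg.mul_conj, mul_smul_comm, mul_one, inv_smul_smul₀ h0]
    _ = _ := by rw [← mul_assoc, h1, one_mul]

theorem IsVersor.reverse_mul_involute {g : Cl n} (hg : IsVersor g) :
    reverse g * involute g = norm g ^ 2 • (1 : Cl n) := by
  rw [reverse_eq, ← involute_mul, hg.conj_mul, involute_smul, involute_one]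

/-- A left inverse of `reverse g` is `‖g‖⁻² g'`. -/
theorem IsVersor.eq_of_mul_reverse {g u : Cl n} (hg : IsVersor g) (h : u * reverse g = 1) :
    u = (norm g ^ 2)⁻¹ • involute g := by
  have h0 := (norm_sq_pos hg.ne_zero).ne'
  calc u = (norm g ^ 2)⁻¹ • (u * (reverse g * involute g)) := by
        rw [hg.reverse_mul_involute, mul_smul_comm, mul_one, inv_smul_smul₀ h0]
    _ = _ := by rw [← mul_assoc, h, one_mul]

/-! ### The subalgebra omitting one generator -/

theorem memSub.mul {a b : Cl n} {i : Fin n} (ha : memSub a i) (hb : memSub b i) :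
    memSub (a * b) i := by
  intro C hC
  change (a * b) C = 0
  rw [← mul_eq, mul_apply]
  refine Finset.sum_eq_zero fun A _ => ?_
  by_cases h : i ∈ A
  · rw [show a A = 0 from ha A h]; ring
  · rw [show b (A ∆ C) = 0 from hb _ (by simp [Finset.mem_symmDiff, h, hC])]; ring

theorem memSub.smul {a : Cl n} {i : Fin n} (r : ℝ) (ha : memSub a i) : memSub (r • a) i := by
  intro A hA
  change r * a A = 0
  rw [show a A = 0 from ha A hA, mul_zero]

theorem memSub.conj {a : Cl n} {i : Fin n} (ha : memSub a i) : memSub (conj a) i := by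
  intro A hA
  change _ * a A = 0
  rw [show a A = 0 from ha A hA, mul_zero]

theorem memSub.involute {a : Cl n} {i : Fin n} (ha : memSub a i) : memSub (involute a) i := by
  intro A hA
  change _ * a A = 0
  rw [show a A = 0 from ha A hA, mul_zero]

theorem memSub.e_mul {m : ℕ} {u : Cl (m + 1)} (hu : memSub u (Fin.last m)) :
    e (Fin.last m) * u = Cl.involute u * e (Fin.last m) := by
  refine ext_apply fun C => ?_
  rw [← mul_eq, ← mul_eq, mul_apply, mul_apply,
    Finset.sum_eq_single {Fin.last m}, Finset.sum_eq_single (C ∆ {Fin.last m})]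
  · rw [symmDiff_comm (C ∆ {Fin.last m}) C, symmDiff_symmDiff_cancel_left,
      symmDiff_comm {Fin.last m} C]
    generalize C ∆ {Fin.last m} = B
    by_cases hB : Fin.last m ∈ B
    · rw [show Cl.involute u B = 0 from hu.involute B hB, show u B = 0 from hu B hB]
      ring
    · have h1 : mulSign {Fin.last m} B = (-1) ^ B.card := by
        rw [mulSign_eq_prod, Finset.prod_singleton]
        exact Finset.prod_eq_pow_card fun b _ => if_pos (Fin.le_last b)
      have h2 : mulSign B {Fin.last m} = 1 := by
        rw [mulSign_eq_prod]
        refine Finset.prod_eq_one fun b hb => ?_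
        rw [Finset.prod_singleton, if_neg]
        intro h
        exact hB (Fin.last_le_iff.mp h ▸ hb)
      rw [h1, h2]
      simp [e, Cl.involute]
  · intro A _ hA
    have h : A ∆ C ≠ {Fin.last m} := fun h => hA (by
      rw [← h, symmDiff_comm A C, symmDiff_symmDiff_cancel_left])
    simp [e, h]
  · simp
  · intro A _ hA
    simp [e, hA]
  · simp

/-- The top coordinate of `g' * z * conj g` is `z_top ‖g‖²` if `g` does not involve `e_top`. -/
theorem IsVersor.sandwich_apply_last {m : ℕ} {g z : Cl (m + 1)} (hg : IsVersor g)
    (hsub : memSub g (Fin.last m)) (hz : IsParavector z) :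
    (involute g * z * conj g) {Fin.last m} = z {Fin.last m} * norm g ^ 2 := by
  set t := z {Fin.last m} with ht
  set z₀ := z - t • e (Fin.last m) with hz₀
  have hz₀sub : memSub z₀ (Fin.last m) := by
    intro A hA
    change z A - t * e (Fin.last m) A = 0
    by_cases h : A = {Fin.last m}
    · simp [h, e, ht]
    · have h1 : 1 < A.card := by
        by_contra! hc
        exact h (Finset.eq_singleton_iff_unique_mem.mpr
          ⟨hA, fun y hy => Finset.card_le_one.mp hc y hy _ hA⟩)
      rw [isParavector_iff.mp hz A h1]
      simp [e, h]
  have hdecomp : involute g * z * conj g =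
      involute g * z₀ * conj g + (t * norm g ^ 2) • e (Fin.last m) := by
    have he : involute g * e (Fin.last m) * conj g = norm g ^ 2 • e (Fin.last m) := by
      rw [mul_assoc, hsub.conj.e_mul, ← mul_assoc, ← involute_mul, hg.mul_conj, involute_smul,
        involute_one, smul_mul_assoc, one_mul]
    rw [hz₀, mul_smul, ← he]
    simp only [mul_sub, sub_mul, mul_smul_comm, smul_mul_assoc]
    abel
  have h0 : (involute g * z₀ * conj g) {Fin.last m} = 0 :=
    ((hsub.involute.mul hz₀sub).mul hsub.conj) _ (Finset.mem_singleton_self _)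
  rw [hdecomp, add_apply, h0, smul_apply]
  simp [e]

/-! ### The Möbius action -/

theorem IsVersor.memSub_inv {g : Cl n} {i : Fin n} (hg : IsVersor g) (h : memSub g i) :
    memSub (inv g) i := by
  rw [hg.inv_eq]
  exact h.conj.smul _

theorem SAVsub.moebius_spec {m : ℕ} (M : SAVsub m) {x : Fin (m + 2) → ℝ}
    (hx : x ∈ upperHalf (m + 1)) :
    IsVersor (cxd M.toSAV x) ∧ IsParavector (moebiusCl M.toSAV x) ∧
      moebiusCl M.toSAV x {Fin.last m} =
        x (Fin.last (m + 1)) / norm (cxd M.toSAV x) ^ 2 := by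
  have hxn : para x {Fin.last m} = x (Fin.last (m + 1)) := para_apply_singleton x _
  have hxp : IsParavector (para x) := ⟨x, rfl⟩
  have hx' : 0 < x (Fin.last (m + 1)) := hx
  have hdet : M.a * reverse M.d - M.b * reverse M.c = 1 := M.det
  by_cases hc : M.c = 0
  · have hrev : reverse (0 : Cl (m + 1)) = 0 := ext_apply fun A => by
      simp [reverse, zero_apply]
    have hq : cxd M.toSAV x = M.d := by
      rw [cxd, hc, mul_eq, zero_mul, zero_add]
    rw [hc, hrev, mul_zero, sub_zero] at hdet
    have hd0 : M.d ≠ 0 := fun h => one_ne_zero' (by rw [← hdet, h, hrev, mul_zero])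
    have hd : IsVersor M.d := (M.prod_d.resolve_left hd0).isVersor
    have h0 := (norm_sq_pos hd.ne_zero).ne'
    have hM : moebiusCl M.toSAV x = M.b * inv M.d +
        ((norm M.d ^ 2)⁻¹ * (norm M.d ^ 2)⁻¹) • (involute M.d * para x * conj M.d) := by
      rw [moebiusCl, hq, axb, mul_eq, mul_eq, hd.eq_of_mul_reverse hdet, add_mul,
        add_comm (_ * inv M.d), hd.inv_eq]
      simp only [smul_mul_assoc, mul_smul_comm, smul_smul]
    rw [hq, hM]
    refine ⟨hd, (M.cond_c0 hc).add ((hd.sandwich _ hxp).smul _), ?_⟩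
    have hb : (M.b * inv M.d) {Fin.last m} = 0 :=
      (M.sub_b.mul (hd.memSub_inv M.sub_d)) _ (Finset.mem_singleton_self _)
    rw [add_apply, hb, smul_apply, hd.sandwich_apply_last M.sub_d hxp, hxn]
    field_simp
    ring
  · have hcv : IsVersor M.c := (M.prod_c.resolve_left hc).isVersor
    have h0 := (norm_sq_pos hcv.ne_zero).ne'
    obtain ⟨hac, hcd⟩ := M.cond_c hc
    rw [mul_eq] at hac hcd
    have hcinv : M.c * inv M.c = 1 := by
      rw [hcv.inv_eq, mul_smul_comm, hcv.mul_conj, inv_smul_smul₀ h0]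
    set y := para x + inv M.c * M.d with hy
    have hyp : IsParavector y := hxp.add hcd
    have hyn : y {Fin.last m} = x (Fin.last (m + 1)) := by
      have h1 : (inv M.c * M.d) {Fin.last m} = 0 :=
        ((hcv.memSub_inv M.sub_c).mul M.sub_d) _ (Finset.mem_singleton_self _)
      rw [hy, add_apply, h1, hxn, add_zero]
    have hyv : IsVersor y := hyp.isVersor fun h => by
      rw [h, zero_apply] at hyn
      exact hx'.ne hyn
    have h0y := (norm_sq_pos hyv.ne_zero).ne'
    have hq : cxd M.toSAV x = M.c * y := by
      rw [hy, mul_add, ← mul_assoc, hcinv, one_mul]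
      rfl
    have hqv : IsVersor (M.c * y) := hcv.mul hyv
    have hu : (M.a * (inv M.c * M.d) - M.b) * reverse M.c = 1 := by
      have h1 : (inv M.c * M.d) * reverse M.c = reverse M.d := by
        rw [← hcd.reverse_eq, ← reverse_mul, ← mul_assoc, hcinv, one_mul]
      rw [sub_mul, mul_assoc, h1, hdet]
    have hnum : axb M.toSAV x = M.a * y - (norm M.c ^ 2)⁻¹ • involute M.c := by
      rw [← hcv.eq_of_mul_reverse hu, hy, axb, mul_eq, mul_add]
      abel
    have hM : moebiusCl M.toSAV x = M.a * inv M.c +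
        (-((norm M.c ^ 2)⁻¹ * (norm M.c ^ 2 * norm y ^ 2)⁻¹)) •
          (involute M.c * conj y * conj M.c) := by
      have h1 : M.a * y * (conj y * conj M.c) = norm y ^ 2 • (M.a * conj M.c) := by
        rw [mul_assoc, ← mul_assoc y, hyv.mul_conj, smul_mul_assoc, one_mul, mul_smul_comm]
      rw [moebiusCl, hq, hnum, mul_eq, hqv.inv_eq, hcv.norm_mul hyv, conj_mul, sub_mul,
        mul_smul_comm, h1, hcv.inv_eq, smul_smul, mul_smul_comm, sub_eq_add_neg, neg_smul]
      congr 1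
      · rw [mul_smul_comm, mul_inv, mul_assoc, inv_mul_cancel₀ h0y, mul_one]
      · simp only [smul_mul_assoc, smul_smul, mul_assoc, mul_comm (norm M.c ^ 2)⁻¹]
    rw [hq, hM]
    refine ⟨hqv, hac.add ((hcv.sandwich _ hyp.conj).smul _), ?_⟩
    have ha : (M.a * inv M.c) {Fin.last m} = 0 :=
      (M.sub_a.mul (hcv.memSub_inv M.sub_c)) _ (Finset.mem_singleton_self _)
    have hcy : conj y {Fin.last m} = -x (Fin.last (m + 1)) := by
      simp [conj, hyn]
    rw [add_apply, ha, smul_apply, hcv.sandwich_apply_last M.sub_c hyp.conj, hcy,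
      hcv.norm_mul hyv]
    field_simp
    ring

end Cl

/-- For `M ∈ SAV(ℝ ⊕ ℝ^{n-1})` and `x ∈ H⁺` (`n = m + 2`): `cx + d` is invertible,
`M<x> = (ax+b)(cx+d)⁻¹` is a paravector lying in `H⁺`, and `(M<x>)ₙ = xₙ/‖cx+d‖²`. -/
theorem moebius_maps_upper_half_space
    (m : ℕ) (M : Cl.SAVsub (m + 1))
    (x : Fin (m + 3) → ℝ) (hx : x ∈ Cl.upperHalf (m + 2)) :
    Cl.IsInvertible (Cl.cxd M.toSAV x) ∧
      Cl.IsParavector (Cl.moebiusCl M.toSAV x) ∧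
      Cl.moebius M.toSAV x ∈ Cl.upperHalf (m + 2) ∧
      Cl.moebius M.toSAV x (Fin.last (m + 2)) =
        x (Fin.last (m + 2)) / Cl.norm (Cl.cxd M.toSAV x) ^ 2 := by
  obtain ⟨hv, hp, hcoord⟩ := M.moebius_spec hx
  have hlast : Cl.moebius M.toSAV x (Fin.last (m + 2)) =
      x (Fin.last (m + 2)) / Cl.norm (Cl.cxd M.toSAV x) ^ 2 := hcoord
  refine ⟨hv.isInvertible, hp, ?_, hlast⟩
  change 0 < Cl.moebius M.toSAV x (Fin.last (m + 2))
  rw [hlast]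
  exact div_pos hx (Cl.norm_sq_pos hv.ne_zero)
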